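/- If A_Q is the Jacobi algebra of a dimer model and A_Q is an order (a prime algebra finitely generated as a module over its center), then A_Q is a cancellation algebra. -/

import Mathlib

open scoped BigOperators

attribute [local instance] Classical.propDecidable

noncomputable section

/-- The underlying data of a (possibly infinite) dimer model: a quiver together with
two distinguished collections of cyclic paths (the positive and negative faces).
Lists of arrows are written in *algebra order*: `[a₁, …, aₖ]` represents the path
`a₁ ⋯ aₖ`, traversing `aₖ` first; so consecutive arrows satisfy `tl aᵢ = hd aᵢ₊₁`. -/
structure DimerData where
  V : Type
  E : Type
  hd : E → V
  tl : E → V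
  facesP : Set (List E)
  facesM : Set (List E)

namespace DimerData

variable (D : DimerData)

def faces : Set (List D.E) := D.facesP ∪ D.facesM

/-- `p` is a path (in algebra order). -/
def IsPath (p : List D.E) : Prop := p.Chain' fun a b => D.tl a = D.hd b

/-- `p` is a path with tail `v` and head `w`. -/
def PathFrom (v w : D.V) (p : List D.E) : Prop :=
  D.IsPath p ∧ (∀ a ∈ p.head?, D.hd a = w) ∧ (∀ a ∈ p.getLast?, D.tl a = v) ∧
    (p = [] → v = w)

/-- `c` is a nonempty cyclic path. -/
def IsCyc (c : List D.E) : Prop :=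
  D.IsPath c ∧ ∃ a ∈ c.head?, ∃ b ∈ c.getLast?, D.tl b = D.hd a

/-- `c` is a cyclic path based at the vertex `v`. -/
def CycAt (v : D.V) (c : List D.E) : Prop := D.IsCyc c ∧ ∀ a ∈ c.head?, D.hd a = v

/-- The axioms of a dimer model: the faces are cyclic paths of length at least 3,
the two sets of faces are disjoint, and every arrow occurs exactly once among the
positive faces and exactly once among the negative faces (uniqueness of the
splitting `s.1 ++ a :: s.2` expresses "exactly once in exactly one cycle"). -/
structure IsDimer : Prop where
  facesP_cyc : ∀ c ∈ D.facesP, D.IsCyc c ∧ 3 ≤ c.length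
  facesM_cyc : ∀ c ∈ D.facesM, D.IsCyc c ∧ 3 ≤ c.length
  disjoint : Disjoint D.facesP D.facesM
  arrowP : ∀ a : D.E, ∃! s : List D.E × List D.E, s.1 ++ a :: s.2 ∈ D.facesP
  arrowM : ∀ a : D.E, ∃! s : List D.E × List D.E, s.1 ++ a :: s.2 ∈ D.facesM

/-- `p` is the positive complement of the arrow `a`: `a * p` is (a rotation of)
a positive face, i.e. `r_a = p⁺ - p⁻` has `p⁺ = p`. -/
def PosComp (a : D.E) (p : List D.E) : Prop := ∃ c ∈ D.facesP, (a :: p) ~r c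

/-- `p` is the negative complement of the arrow `a`. -/
def NegComp (a : D.E) (p : List D.E) : Prop := ∃ c ∈ D.facesM, (a :: p) ~r c

/-- The Euler characteristic `#Q₀ - #Q₁ + #Q₂` of a dimer model. -/
def eulerChar : ℤ := (Nat.card D.V : ℤ) - Nat.card D.E + Nat.card ↥D.faces

/-- The homology 1-chain of a path: the multiplicity of each arrow. -/
def chain (p : List D.E) : D.E → ℤ := fun a => (p.count a : ℤ)

/-- The span of the boundaries of the faces (the image of `d : ℤ^{Q₂} → ℤ^{Q₁}`). -/
def bd2span : Submodule ℤ (D.E → ℤ) :=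
  Submodule.span ℤ {x | ∃ c ∈ D.faces, x = D.chain c}

/-- The number of arrows of a path lying in a given set of arrows (the degree of
the path for the grading induced by a perfect matching). -/
def pdeg (P : Set D.E) (p : List D.E) : ℕ := p.countP fun a => decide (a ∈ P)

/-- A perfect matching: a set of arrows meeting every face exactly once. -/
def IsPM (P : Set D.E) : Prop := ∀ c ∈ D.faces, D.pdeg P c = 1

/-- Combinatorial homotopy of paths: the congruence generated by the Jacobi
relations `p⁺ ∼ p⁻` together with contracting any face cycle to a trivial path.
Two directed paths in the dimer model are homotopic in the underlying surface
iff they are related by this relation. -/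
inductive Htp : List D.E → List D.E → Prop
  | refl (p) : Htp p p
  | symm {p q} : Htp p q → Htp q p
  | trans {p q r} : Htp p q → Htp q r → Htp p r
  | append {p p' q q'} : Htp p p' → Htp q q' → Htp (p ++ q) (p' ++ q')
  | jac {a p q} : D.PosComp a p → D.NegComp a q → Htp p q
  | face {c c'} : c ∈ D.faces → c' ~r c → Htp c' []

section Fin

variable [Fintype D.E]

/-- The boundary map `ℤ^{Q₁} → ℤ^{Q₀}`, `a ↦ h(a) - t(a)`. -/
def bd1 (x : D.E → ℤ) : D.V → ℤ := fun v =>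
  (∑ a : D.E, if D.hd a = v then x a else 0) - ∑ a : D.E, if D.tl a = v then x a else 0

/-- A consistent R-charge: positive, faces of total degree 2, and the vertex
condition `Σ_{h(a)=v} (1 - R_a) + Σ_{t(a)=v} (1 - R_a) = 2`. -/
def ConsistentR (R : D.E → ℝ) : Prop :=
  (∀ a : D.E, 0 < R a) ∧
  (∀ c ∈ D.faces, (c.map R).sum = 2) ∧
  (∀ v : D.V,
    (∑ a : D.E, if D.hd a = v then 1 - R a else 0) +
      (∑ a : D.E, if D.tl a = v then 1 - R a else 0) = 2)

end Fin

/-! ### The Jacobi algebra -/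

inductive Gen (D : DimerData) : Type
  | vert : D.V → Gen D
  | arr : D.E → Gen D

/-- The free algebra on the vertices and arrows. -/
abbrev pre := FreeAlgebra ℂ (Gen D)

def genV (v : D.V) : D.pre := FreeAlgebra.ι ℂ (Gen.vert v)
def genE (a : D.E) : D.pre := FreeAlgebra.ι ℂ (Gen.arr a)

/-- The element of the free algebra corresponding to a path (in algebra order). -/
def word (p : List D.E) : D.pre := (p.map D.genE).prod

section Alg

variable [Fintype D.V]

/-- The defining relations of the path algebra `ℂQ`: the vertices are a complete
set of orthogonal idempotents and arrows compose according to heads and tails. -/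
inductive PARel : D.pre → D.pre → Prop
  | vv (v : D.V) : PARel (D.genV v * D.genV v) (D.genV v)
  | vw (v w : D.V) (h : v ≠ w) : PARel (D.genV v * D.genV w) 0
  | unit : PARel (∑ v : D.V, D.genV v) 1
  | hd (a : D.E) : PARel (D.genV (D.hd a) * D.genE a) (D.genE a)
  | tl (a : D.E) : PARel (D.genE a * D.genV (D.tl a)) (D.genE a)

/-- The relations of the Jacobi algebra: path algebra relations together with
the relations `r_a = p⁺ - p⁻` for every arrow `a`. -/
inductive JRel : D.pre → D.pre → Prop
  | pa {x y} : D.PARel x y → JRel x y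
  | jac {a p q} : D.PosComp a p → D.NegComp a q → JRel (D.word p) (D.word q)

/-- The path algebra `ℂQ`. -/
abbrev PathAlg := RingQuot D.PARel

/-- The Jacobi algebra `A_Q` of the dimer model. -/
abbrev Jac := RingQuot D.JRel

def toJac : D.pre →+* D.Jac := RingQuot.mkRingHom D.JRel

/-- The element of the Jacobi algebra given by a (nonempty) path. -/
def pathE (p : List D.E) : D.Jac := D.toJac (D.word p)

/-- The idempotent of a vertex in the Jacobi algebra. -/
def vtx (v : D.V) : D.Jac := D.toJac (D.genV v)

/-- The element of a possibly trivial path with tail vertex `v`. -/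
def pathAt (v : D.V) (p : List D.E) : D.Jac := if p = [] then D.vtx v else D.pathE p

/-- `A_Q` is a cancellation algebra: `p a = q a → p = q` and `a p = a q → p = q`
for every arrow `a` and all paths `p`, `q` (with matching heads and tails). -/
def Cancellation : Prop :=
  ∀ (a : D.E) (p q : List D.E) (v : D.V),
    (D.PathFrom (D.hd a) v p → D.PathFrom (D.hd a) v q →
      D.pathAt (D.hd a) p * D.pathE [a] = D.pathAt (D.hd a) q * D.pathE [a] →
      D.pathAt (D.hd a) p = D.pathAt (D.hd a) q) ∧
    (D.PathFrom v (D.tl a) p → D.PathFrom v (D.tl a) q →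
      D.pathE [a] * D.pathAt v p = D.pathE [a] * D.pathAt v q →
      D.pathAt v p = D.pathAt v q)

/-- A choice, for every vertex, of a face cycle based at that vertex. -/
def CycChoice (c : D.V → List D.E) : Prop :=
  ∀ v : D.V, c v ∈ D.faces ∧ D.CycAt v (c v)

/-- The canonical central element `ℓ = Σ_v c_v` attached to a choice of cycles. -/
def ell (c : D.V → List D.E) : D.Jac := ∑ v : D.V, D.pathE (c v)

end Alg

end DimerData

/-- `Walk h t x y p`: the list of arrows `p`, in algebra order, is a path from `x` to `y`
with respect to the head and tail maps `h` and `t`. -/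
inductive Walk {E X : Type} (h t : E → X) : X → X → List E → Prop
  | nil (x) : Walk h t x x []
  | cons {x y a p} : Walk h t x y p → t a = y → Walk h t x (h a) (a :: p)

namespace Walk

variable {E X : Type} {h t : E → X}

lemma append {x y z : X} {p q : List E} (hq : Walk h t x y q) (hp : Walk h t y z p) :
    Walk h t x z (p ++ q) := by
  induction hp with
  | nil => exact hq
  | cons _ e ih => exact ih.cons e

lemma singleton (a : E) : Walk h t (t a) (h a) [a] := (Walk.nil _).cons rfl

lemma of_isChain {b : E} : ∀ {p : List E} {a : E},
    List.IsChain (fun x y => t x = h y) (a :: (p ++ [b])) → Walk h t (h b) (t a) p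
  | [], a, H => by
    have : t a = h b := by simpa using H
    rw [this]; exact Walk.nil _
  | c :: p, a, H => by
    rw [List.cons_append, List.isChain_cons_cons] at H
    rw [H.1]
    exact (of_isChain H.2).cons rfl

lemma head_eq {x y : X} {a : E} {p : List E} (H : Walk h t x y (a :: p)) : y = h a := by
  cases H; rfl

lemma tail_eq {x : X} {b : E} : ∀ {r : List E} {y : X}, Walk h t x y (r ++ [b]) → t b = x
  | [], _, .cons H e => by cases H; exact e
  | _ :: _, _, .cons H _ => tail_eq H

end Walk

namespace DimerData

section Combinatorics

variable (D : DimerData)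

/-- `p` complements the arrow `a` to a face of either sign. -/
def Comp (a : D.E) (p : List D.E) : Prop := ∃ c ∈ D.faces, (a :: p) ~r c

/-- `inl a` is the end of `a` at its head, `inr a` its end at its tail. They are
related when the two arrows are consecutive in a face. -/
inductive Corner : D.E ⊕ D.E → D.E ⊕ D.E → Prop
  | mk {x y q} : D.Comp x (y :: q) → Corner (Sum.inr x) (Sum.inl y)

/-- The connected components of the links of the vertices. -/
def Link : Type := Quot D.Corner

def lhd (a : D.E) : D.Link := Quot.mk _ (Sum.inl a)
def ltl (a : D.E) : D.Link := Quot.mk _ (Sum.inr a)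

variable {D}

lemma walk_of_pathFrom {v w : D.V} {p : List D.E} (H : D.PathFrom v w p) :
    Walk D.hd D.tl v w p := by
  induction p generalizing w with
  | nil => rw [H.2.2.2 rfl]; exact Walk.nil _
  | cons a p ih =>
    obtain ⟨h1, h2, h3, -⟩ := H
    have h2 : D.hd a = w := by simpa using h2
    subst h2
    refine Walk.cons (ih (w := D.tl a) ⟨h1.tail, ?_, ?_, ?_⟩) rfl
    · cases p with
      | nil => simp
      | cons b p =>
        have := (List.isChain_cons_cons.1 h1).1
        simpa using this.symm
    · cases p with
      | nil => simp
      | cons b p => simpa [List.getLast?_cons_cons] using h3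
    · rintro rfl
      simpa using (h3 a (by simp)).symm

namespace IsDimer

variable (hD : D.IsDimer)
include hD

lemma face_cyc {c : List D.E} (hc : c ∈ D.faces) : D.IsCyc c ∧ 3 ≤ c.length :=
  hc.elim (hD.facesP_cyc c) (hD.facesM_cyc c)

lemma exists_posComp (a : D.E) : ∃ p, D.PosComp a p := by
  obtain ⟨s, hs, -⟩ := hD.arrowP a
  exact ⟨s.2 ++ s.1, _, hs, List.isRotated_append (l := a :: s.2) (l' := s.1)⟩

lemma exists_negComp (a : D.E) : ∃ p, D.NegComp a p := by
  obtain ⟨s, hs, -⟩ := hD.arrowM a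
  exact ⟨s.2 ++ s.1, _, hs, List.isRotated_append (l := a :: s.2) (l' := s.1)⟩

lemma two_le_length {a : D.E} {p : List D.E} (h : D.Comp a p) : 2 ≤ p.length := by
  obtain ⟨c, hc, hr⟩ := h
  have := (hD.face_cyc hc).2
  rw [← hr.perm.length_eq] at this
  simpa using this

lemma comp_walk {a : D.E} {p : List D.E} (h : D.Comp a p) :
    Walk D.hd D.tl (D.hd a) (D.tl a) p := by
  obtain ⟨c, hc, hr⟩ := h
  apply Walk.of_isChain
  rw [← Cycle.chain_coe_cons, Cycle.coe_eq_coe.2 hr]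
  obtain ⟨h1, x, hx, y, hy, hxy⟩ := (hD.face_cyc hc).1
  cases c with
  | nil => simp at hx
  | cons b q =>
    rw [Cycle.chain_coe_cons, ← List.cons_append]
    refine List.IsChain.append h1 (by simp) ?_
    intro z hz w hw
    have : z = y := Option.some.inj (hz.symm.trans hy)
    have : x = b := by simpa using hx.symm
    have : w = b := by simpa using hw.symm
    simp_all

lemma comp_lwalk {a : D.E} {p : List D.E} (h : D.Comp a p) :
    Walk D.lhd D.ltl (D.lhd a) (D.ltl a) p := by
  apply Walk.of_isChain
  rw [List.isChain_iff_forall_rel_of_append_cons_cons]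
  intro x y u w huw
  apply Quot.sound
  have h2 := hD.two_le_length h
  obtain ⟨c, hc, hr⟩ := h
  rcases w.eq_nil_or_concat with rfl | ⟨w', e, rfl⟩
  · have e1 : a :: p ++ [a] = (u ++ [x]) ++ [y] := by simpa using huw
    obtain ⟨e2, e3⟩ := List.append_inj' e1 rfl
    have e3 : a = y := by simpa using e3
    subst e3
    cases u with
    | nil =>
      have : p = [] := by simpa using (List.cons.inj e2).2
      simp [this] at h2
    | cons b u =>
      obtain ⟨rfl, rfl⟩ := List.cons.inj e2
      exact .mk (q := u) ⟨c, hc, (List.isRotated_append (l := [x]) (l' := a :: u)).trans hr⟩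
  · have e1 : a :: p ++ [a] = (u ++ x :: y :: w') ++ [e] := by simpa using huw
    have e2 := (List.append_inj' e1 rfl).1
    refine .mk (q := w' ++ u) ⟨c, hc, ?_⟩
    rw [e2] at hr
    exact (List.isRotated_append (l := x :: y :: w') (l' := u)).trans hr

end IsDimer

end Combinatorics

section Algebra

variable {D : DimerData} [Fintype D.V]

lemma pathE_nil : D.pathE [] = 1 := by simp [pathE, word]

lemma pathE_append (p q : List D.E) : D.pathE (p ++ q) = D.pathE p * D.pathE q := by
  simp [pathE, word]

lemma pathE_cons (a : D.E) (p : List D.E) : D.pathE (a :: p) = D.pathE [a] * D.pathE p :=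
  pathE_append [a] p

lemma toJac_rel {x y : D.pre} (h : D.JRel x y) : D.toJac x = D.toJac y :=
  RingQuot.mkRingHom_rel h

lemma pathE_singleton (a : D.E) : D.pathE [a] = D.toJac (D.genE a) := by simp [pathE, word]

lemma vtx_mul_self (v : D.V) : D.vtx v * D.vtx v = D.vtx v := by
  simpa [vtx] using toJac_rel (.pa (.vv v))

lemma vtx_mul_vtx {v w : D.V} (h : v ≠ w) : D.vtx v * D.vtx w = 0 := by
  simpa [vtx] using toJac_rel (.pa (.vw v w h))

lemma sum_vtx : ∑ v : D.V, D.vtx v = 1 := by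
  simpa [vtx] using toJac_rel (.pa (.unit (D := D)))

lemma vtx_mul_arrow (a : D.E) : D.vtx (D.hd a) * D.pathE [a] = D.pathE [a] := by
  simpa [vtx, pathE_singleton] using toJac_rel (.pa (.hd a))

lemma arrow_mul_vtx (a : D.E) : D.pathE [a] * D.vtx (D.tl a) = D.pathE [a] := by
  simpa [vtx, pathE_singleton] using toJac_rel (.pa (.tl a))

lemma vtx_mul_pathE {v w : D.V} {p : List D.E} (H : Walk D.hd D.tl v w p) (hp : p ≠ []) :
    D.vtx w * D.pathE p = D.pathE p := by
  cases H with
  | nil => exact absurd rfl hp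
  | cons _ _ => rw [pathE_cons, ← mul_assoc, vtx_mul_arrow]

lemma pathE_mul_vtx {v w : D.V} {p : List D.E} (H : Walk D.hd D.tl v w p) (hp : p ≠ []) :
    D.pathE p * D.vtx v = D.pathE p := by
  induction H with
  | nil => exact absurd rfl hp
  | @cons y a q H' e ih =>
    by_cases hq : q = []
    · subst hq
      cases H'
      rw [← e, arrow_mul_vtx]
    · rw [pathE_cons, mul_assoc, ih hq]

lemma vtx_mul_pathAt {v w : D.V} {p : List D.E} (H : Walk D.hd D.tl v w p) :
    D.vtx w * D.pathAt v p = D.pathAt v p := by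
  unfold pathAt
  split_ifs with hp
  · subst hp; cases H; exact vtx_mul_self _
  · exact vtx_mul_pathE H hp

lemma pathAt_mul_vtx {v w : D.V} {p : List D.E} (H : Walk D.hd D.tl v w p) :
    D.pathAt v p * D.vtx v = D.pathAt v p := by
  unfold pathAt
  split_ifs with hp
  · exact vtx_mul_self _
  · exact pathE_mul_vtx H hp

lemma IsDimer.pathE_comp_eq (hD : D.IsDimer) {a : D.E} {p q : List D.E}
    (hp : D.Comp a p) (hq : D.Comp a q) : D.pathE p = D.pathE q := by
  have jac : ∀ {p q}, D.PosComp a p → D.NegComp a q → D.pathE p = D.pathE q :=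
    fun h1 h2 => toJac_rel (.jac h1 h2)
  obtain ⟨p0, hp0⟩ := hD.exists_posComp a
  obtain ⟨q0, hq0⟩ := hD.exists_negComp a
  have key : ∀ {p}, D.Comp a p → D.pathE p = D.pathE p0 := by
    rintro p ⟨c, hc | hc, hr⟩
    · rw [jac ⟨c, hc, hr⟩ hq0, jac hp0 hq0]
    · exact (jac hp0 ⟨c, hc, hr⟩).symm
  rw [key hp, key hq]

/-! ### Representations on vertices decorated by an automaton state -/

section Rep

variable {Ω : Type} (f : D.E → Ω → Ω)

def repGen : Gen D → Module.End ℂ (D.V × Ω →₀ ℂ)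
  | .vert v => Finsupp.linearCombination ℂ fun x =>
      if x.1 = v then Finsupp.single x 1 else 0
  | .arr a => Finsupp.linearCombination ℂ fun x =>
      if x.1 = D.tl a then Finsupp.single (D.hd a, f a x.2) 1 else 0

def repPre : D.pre →ₐ[ℂ] Module.End ℂ (D.V × Ω →₀ ℂ) := FreeAlgebra.lift ℂ (repGen f)

omit [Fintype D.V] in
lemma repPre_genV (v : D.V) (x : D.V × Ω) :
    repPre f (D.genV v) (Finsupp.single x 1) = if x.1 = v then Finsupp.single x 1 else 0 := by
  simp [repPre, genV, repGen]

omit [Fintype D.V] in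
lemma repPre_genE (a : D.E) (x : D.V × Ω) :
    repPre f (D.genE a) (Finsupp.single x 1) =
      if x.1 = D.tl a then Finsupp.single (D.hd a, f a x.2) 1 else 0 := by
  simp [repPre, genE, repGen]

omit [Fintype D.V] in
lemma word_cons (a : D.E) (p : List D.E) : D.word (a :: p) = D.genE a * D.word p := by
  simp [word]

omit [Fintype D.V] in
lemma repPre_word {v w : D.V} {p : List D.E} (H : Walk D.hd D.tl v w p) (ω : Ω) :
    repPre f (D.word p) (Finsupp.single (v, ω) 1) = Finsupp.single (w, p.foldr f ω) 1 := by
  induction H with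
  | nil => simp [word]
  | cons _ e ih => simp [word_cons, ih, repPre_genE, e]

omit [Fintype D.V] in
lemma repPre_word_of_ne {v w u : D.V} {p : List D.E} (H : Walk D.hd D.tl v w p) (hp : p ≠ [])
    (hu : u ≠ v) (ω : Ω) : repPre f (D.word p) (Finsupp.single (u, ω) 1) = 0 := by
  induction H with
  | nil => exact absurd rfl hp
  | @cons y a q H' e ih =>
    by_cases hq : q = []
    · subst hq
      cases H'
      rw [word_cons]
      simp [word, repPre_genE, e, hu]
    · rw [word_cons, map_mul, Module.End.mul_apply, ih hq, map_zero]

variable {f}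

lemma repPre_rel (hD : D.IsDimer)
    (hf : ∀ a p q, D.PosComp a p → D.NegComp a q → ∀ ω, p.foldr f ω = q.foldr f ω)
    ⦃x y : D.pre⦄ (h : D.JRel x y) :
    (repPre f).toRingHom x = (repPre f).toRingHom y := by
  simp only [AlgHom.toRingHom_eq_coe, RingHom.coe_coe]
  refine Finsupp.lhom_ext' fun ⟨u, ω⟩ => LinearMap.ext_ring ?_
  simp only [LinearMap.comp_apply, Finsupp.lsingle_apply]
  cases h with
  | pa h =>
    cases h with
    | vv v => by_cases e : u = v <;> simp [repPre_genV, e]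
    | vw v w h =>
      by_cases e : u = w
      · subst e; simp [repPre_genV, h.symm]
      · simp [repPre_genV, e]
    | unit => simp [repPre_genV]
    | hd a => by_cases e : u = D.tl a <;> simp [repPre_genV, repPre_genE, e]
    | tl a => by_cases e : u = D.tl a <;> simp [repPre_genV, repPre_genE, e]
  | @jac a p q hp hq =>
    have hp' : D.Comp a p := hp.imp fun c h => ⟨.inl h.1, h.2⟩
    have hq' : D.Comp a q := hq.imp fun c h => ⟨.inr h.1, h.2⟩
    by_cases e : u = D.hd a
    · subst e
      rw [repPre_word f (hD.comp_walk hp'), repPre_word f (hD.comp_walk hq'), hf a p q hp hq]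
    · rw [repPre_word_of_ne f (hD.comp_walk hp') _ e, repPre_word_of_ne f (hD.comp_walk hq') _ e]
      · rintro rfl; simpa using hD.two_le_length hq'
      · rintro rfl; simpa using hD.two_le_length hp'

lemma exists_rep (hD : D.IsDimer)
    (hf : ∀ a p q, D.PosComp a p → D.NegComp a q → ∀ ω, p.foldr f ω = q.foldr f ω) :
    ∃ ρ : D.Jac →+* Module.End ℂ (D.V × Ω →₀ ℂ),
      ∀ {v w : D.V} {p : List D.E}, Walk D.hd D.tl v w p → ∀ ω : Ω,
        ρ (D.pathE p) (Finsupp.single (v, ω) 1) = Finsupp.single (w, p.foldr f ω) 1 := by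
  refine ⟨RingQuot.lift ⟨(repPre f).toRingHom, repPre_rel hD hf⟩, fun H ω => ?_⟩
  rw [pathE, toJac, RingQuot.lift_mkRingHom_apply]
  exact repPre_word f H ω

end Rep

/-- The state counts arrows, up to two. -/
lemma exists_rep_length (hD : D.IsDimer) :
    ∃ ρ : D.Jac →+* Module.End ℂ (D.V × ℕ →₀ ℂ),
      ∀ {v w : D.V} {p : List D.E}, Walk D.hd D.tl v w p →
        ρ (D.pathE p) (Finsupp.single (v, 0) 1) = Finsupp.single (w, min p.length 2) 1 := by
  have key : ∀ (p : List D.E) (n : ℕ), n ≤ 2 →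
      p.foldr (fun _ n => min (n + 1) 2) n = min (n + p.length) 2 := by
    intro p n hn
    induction p with
    | nil => simp [hn]
    | cons a p ih => rw [List.foldr_cons, ih, List.length_cons]; omega
  have key2 : ∀ (p : List D.E) (n : ℕ), 2 ≤ p.length →
      p.foldr (fun _ n => min (n + 1) 2) n = 2 := by
    intro p n hp
    obtain ⟨q, a, rfl⟩ := (List.eq_nil_or_concat p).resolve_left (by rintro rfl; simp at hp)
    rw [List.concat_eq_append, List.foldr_append, List.foldr_cons, List.foldr_nil, key _ _ (by omega)]
    simp at hp
    omega
  obtain ⟨ρ, hρ⟩ := exists_rep (f := fun (_ : D.E) n => min (n + 1) 2) hD (by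
    intro a p q hp hq n
    rw [key2 p _ (hD.two_le_length (hp.imp fun c h => ⟨.inl h.1, h.2⟩)),
      key2 q _ (hD.two_le_length (hq.imp fun c h => ⟨.inr h.1, h.2⟩))])
  refine ⟨ρ, fun H => ?_⟩
  rw [hρ H, key _ _ (by omega), zero_add]

lemma IsDimer.pathE_ne_zero (hD : D.IsDimer) {v w : D.V} {p : List D.E}
    (H : Walk D.hd D.tl v w p) : D.pathE p ≠ 0 := by
  obtain ⟨ρ, hρ⟩ := exists_rep_length hD
  intro h
  have := hρ H
  rw [h] at this
  simpa using this.symm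

lemma IsDimer.arrow_ne (hD : D.IsDimer) {a : D.E} {v w : D.V} {p : List D.E}
    (H : Walk D.hd D.tl v w p) (hv : v = D.tl a) (hp : 2 ≤ p.length) :
    D.pathE [a] ≠ D.pathE p := by
  obtain ⟨ρ, hρ⟩ := exists_rep_length hD
  intro h
  subst hv
  have h1 := hρ H
  rw [← h, hρ (Walk.singleton a), min_eq_right hp] at h1
  have := (Finsupp.single_left_inj one_ne_zero).1 h1
  simp at this

/-! ### Decomposition of paths into pieces within a link component -/

section Pieces

/-- Extend a stack of pieces, whose top piece ends at the given link component, by a path `x`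
from `l` to `l'`. -/
def push (l l' : D.Link) (x : D.Jac) : Option D.Link × List D.Jac → Option D.Link × List D.Jac
  | (_, []) => (some l', [x])
  | (s, m :: ms) => if s = some l then (some l', (x * m) :: ms) else (some l', x :: m :: ms)

def step (a : D.E) : Option D.Link × List D.Jac → Option D.Link × List D.Jac :=
  push (D.ltl a) (D.lhd a) (D.pathE [a])

lemma push_push (l l' l'' : D.Link) (x y : D.Jac) (ω : Option D.Link × List D.Jac) :
    push l' l'' y (push l l' x ω) = push l l'' (y * x) ω := by
  obtain ⟨s, _ | ⟨m, ms⟩⟩ := ω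
  · simp [push]
  · by_cases h : s = some l <;> simp [push, h, mul_assoc]

lemma foldr_step_lwalk {l l' : D.Link} {p : List D.E} (H : Walk D.lhd D.ltl l l' p)
    (hp : p ≠ []) (ω : Option D.Link × List D.Jac) :
    p.foldr step ω = push l l' (D.pathE p) ω := by
  induction H with
  | nil => exact absurd rfl hp
  | @cons y a q H' e ih =>
    by_cases hq : q = []
    · subst hq
      cases H'
      subst e
      rfl
    · rw [List.foldr_cons, ih hq, step, e, push_push, ← pathE_cons]

lemma exists_rep_pieces (hD : D.IsDimer) :
    ∃ ρ : D.Jac →+* Module.End ℂ (D.V × (Option D.Link × List D.Jac) →₀ ℂ),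
      ∀ {v w : D.V} {p : List D.E}, Walk D.hd D.tl v w p → ∀ ω,
        ρ (D.pathE p) (Finsupp.single (v, ω) 1) = Finsupp.single (w, p.foldr step ω) 1 := by
  refine exists_rep hD fun a p q hp hq ω => ?_
  have hp' : D.Comp a p := hp.imp fun c h => ⟨.inl h.1, h.2⟩
  have hq' : D.Comp a q := hq.imp fun c h => ⟨.inr h.1, h.2⟩
  rw [foldr_step_lwalk (hD.comp_lwalk hp'), foldr_step_lwalk (hD.comp_lwalk hq'),
    hD.pathE_comp_eq hp' hq']
  · rintro rfl; simpa using hD.two_le_length hq'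
  · rintro rfl; simpa using hD.two_le_length hp'

/-- The list of pieces of a path. -/
def pieces (p : List D.E) : List D.Jac := (p.foldr step (none, [])).2

lemma pieces_ne_nil (a : D.E) (p : List D.E) : pieces (a :: p) ≠ [] := by
  unfold pieces
  rw [List.foldr_cons]
  generalize p.foldr step (none, []) = ω
  obtain ⟨s, _ | ⟨m, ms⟩⟩ := ω
  · simp [step, push]
  · simp only [step, push]; split_ifs <;> simp

lemma step_fst (a : D.E) (ω : Option D.Link × List D.Jac) : (step a ω).1 = some (D.lhd a) := by
  obtain ⟨s, _ | ⟨m, ms⟩⟩ := ω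
  · simp [step, push]
  · simp only [step, push]; split_ifs <;> simp

lemma step_append (a : D.E) (s : Option D.Link) (ms ns : List D.Jac) (h : ms ≠ []) :
    step a (s, ms ++ ns) = (some (D.lhd a), (step a (s, ms)).2 ++ ns) := by
  obtain ⟨m, ms, rfl⟩ := List.exists_cons_of_ne_nil h
  simp only [step, push, List.cons_append]
  split_ifs <;> simp

lemma length_step (a : D.E) (s : Option D.Link) {ms ns : List D.Jac} (hm : ms ≠ []) (hn : ns ≠ [])
    (h : ms.length = ns.length) : (step a (s, ms)).2.length = (step a (s, ns)).2.length := by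
  obtain ⟨m, ms, rfl⟩ := List.exists_cons_of_ne_nil hm
  obtain ⟨n, ns, rfl⟩ := List.exists_cons_of_ne_nil hn
  simp only [step, push]
  split_ifs <;> simpa using h

/-- A path starting with a cut is stacked on top of the previous pieces. -/
lemma foldr_step_of_cut (q : List D.E) (a : D.E) (s : Option D.Link) (ms : List D.Jac)
    (h : ms = [] ∨ s ≠ some (D.ltl a)) :
    (q ++ [a]).foldr step (s, ms) =
      (((q ++ [a]).foldr step (none, [])).1, pieces (q ++ [a]) ++ ms) := by
  induction q with
  | nil =>
    obtain _ | ⟨m, ms⟩ := ms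
    · simp [step, push, pieces]
    · have h : s ≠ some (D.ltl a) := by simpa using h
      simp [step, push, pieces, h]
  | cons b q ih =>
    have hne : pieces (q ++ [a]) ≠ [] := by
      cases q with
      | nil => exact pieces_ne_nil _ _
      | cons c q => exact pieces_ne_nil _ _
    rw [List.cons_append, List.foldr_cons, ih, step_append _ _ _ _ hne, List.foldr_cons, step_fst]
    rfl

/-- A path continuing the top piece does not create a new piece at its start. -/
lemma length_foldr_step (q : List D.E) (a : D.E) (m : D.Jac) :
    ((q ++ [a]).foldr step (some (D.ltl a), [m])).1 = ((q ++ [a]).foldr step (none, [])).1 ∧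
    ((q ++ [a]).foldr step (some (D.ltl a), [m])).2 ≠ [] ∧
    ((q ++ [a]).foldr step (some (D.ltl a), [m])).2.length = (pieces (q ++ [a])).length := by
  induction q with
  | nil => simp [step, push, pieces]
  | cons b q ih =>
    have hne : pieces (q ++ [a]) ≠ [] := by
      cases q with
      | nil => exact pieces_ne_nil _ _
      | cons c q => exact pieces_ne_nil _ _
    obtain ⟨h1, h2, h3⟩ := ih
    have h4 := length_step b ((q ++ [a]).foldr step (none, [])).1 h2 hne h3
    refine ⟨?_, ?_, ?_⟩
    · simp only [List.cons_append, List.foldr_cons, step_fst]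
    · rw [List.cons_append, List.foldr_cons, ← List.length_pos_iff]
      rw [← Prod.eta ((q ++ [a]).foldr step (some (D.ltl a), [m])), h1, h4, List.length_pos_iff]
      exact pieces_ne_nil b (q ++ [a])
    · rw [List.cons_append, List.foldr_cons]
      rw [← Prod.eta ((q ++ [a]).foldr step (some (D.ltl a), [m])), h1, h4]
      rfl

lemma prod_pieces (p : List D.E) : (pieces p).prod = D.pathE p := by
  induction p with
  | nil => simp [pieces, pathE_nil]
  | cons a p ih =>
    rw [pathE_cons, ← ih]
    unfold pieces
    rw [List.foldr_cons]
    generalize p.foldr step (none, []) = ω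
    obtain ⟨s, _ | ⟨m, ms⟩⟩ := ω
    · simp [step, push]
    · simp only [step, push]; split_ifs <;> simp [mul_assoc]

end Pieces

end Algebra

end DimerData

/-- An algebra generated by `n` elements as a module satisfies the standard identity of every
degree exceeding `n`. -/
lemma exists_standard_identity (R A : Type*) [CommRing R] [Ring A] [Algebra R A]
    [Module.Finite R A] :
    ∃ k : ℕ, ∀ x : Fin k → A,
      ∑ σ : Equiv.Perm (Fin k), Equiv.Perm.sign σ • (List.ofFn fun i => x (σ i)).prod = 0 := by
  obtain ⟨n, φ, hφ⟩ := Module.Finite.exists_fin' R A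
  refine ⟨n + 1, fun x => ?_⟩
  set f : A [⋀^Fin (n + 1)]→ₗ[R] A :=
    MultilinearMap.alternatization (MultilinearMap.mkPiAlgebraFin R (n + 1) A) with hf
  have h0 : f.compLinearMap φ = 0 := by
    refine Module.Basis.ext_alternating (Pi.basisFun R (Fin n)) fun v hv => ?_
    simpa using Fintype.card_le_of_injective v hv
  choose y hy using fun i => hφ (x i)
  have h1 : f x = 0 := by
    have := congrArg (fun g => g y) h0
    simpa [Function.comp_def, hy] using this
  rw [hf, MultilinearMap.alternatization_apply] at h1
  simpa [MultilinearMap.mkPiAlgebraFin_apply] using h1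

namespace DimerData

section Main

variable {D : DimerData} [Fintype D.V]

/-- Two loops at `v` whose lists of pieces have the same length, and which have to be cut
when they are concatenated, generate a free algebra unless they are equal. -/
lemma pieces_eq [Module.Finite (Subring.center D.Jac) D.Jac]
    {v : D.V} {s : Option D.Link} {G : Bool → List D.Jac} {g : Bool → D.Jac}
    (ρ : D.Jac →+* Module.End ℂ (D.V × (Option D.Link × List D.Jac) →₀ ℂ))
    (hρ : ∀ b t ms, (ms = [] ∨ t = s) →
      ρ (g b) (Finsupp.single (v, t, ms) 1) = Finsupp.single (v, s, G b ++ ms) 1)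
    (hlen : (G true).length = (G false).length) : G true = G false := by
  by_contra hne
  obtain ⟨k, hk⟩ := exists_standard_identity (Subring.center D.Jac) D.Jac
  have hGinj : Function.Injective G := by
    intro b c h
    cases b <;> cases c <;> simp_all
  have hGlen : ∀ b c, (G b).length = (G c).length := by
    intro b c
    cases b <;> cases c <;> simp_all
  have act : ∀ bs : List Bool, ∃ t, (bs = [] ∨ t = s) ∧
      ρ (bs.map g).prod (Finsupp.single (v, none, []) 1) =
        Finsupp.single (v, t, (bs.map G).flatten) 1 := by
    intro bs
    induction bs with
    | nil => exact ⟨none, by simp⟩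
    | cons b bs ih =>
      obtain ⟨t, ht, ih⟩ := ih
      refine ⟨s, .inr rfl, ?_⟩
      rw [List.map_cons, List.prod_cons, map_mul, Module.End.mul_apply, ih, hρ]
      · simp
      · exact ht.imp (by rintro rfl; rfl) id
  let u : Fin k → List Bool := fun i => List.ofFn fun j => decide (j = i)
  have hu : Function.Injective u := by
    intro i j h
    have := congrFun (List.ofFn_injective h) i
    simpa using this
  let U : Equiv.Perm (Fin k) → List Bool := fun σ => (List.ofFn fun i => u (σ i)).flatten
  have hlen_eq : ∀ σ, (U σ).length = k * k := by
    intro σ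
    simp [U, u, List.length_flatten, Function.comp_def]
  have hU : Function.Injective U := by
    intro σ τ h
    have : (List.ofFn fun i => u (σ i)) = List.ofFn fun i => u (τ i) := by
      rw [List.eq_iff_flatten_eq]
      refine ⟨h, ?_⟩
      simp [u, Function.comp_def]
    ext i
    exact congrArg _ (hu (congrFun (List.ofFn_injective this) i))
  have hprod : ∀ σ : Equiv.Perm (Fin k),
      (List.ofFn fun i => ((u (σ i)).map g).prod).prod = ((U σ).map g).prod := by
    intro σ
    simp only [U, List.map_flatten, List.prod_flatten, List.map_ofFn, Function.comp_def]
  choose t _ ht using act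
  have hF : Function.Injective fun σ => (v, t (U σ), ((U σ).map G).flatten) := by
    intro σ τ h
    have h2 : ((U σ).map G).flatten = ((U τ).map G).flatten := (Prod.ext_iff.1 (Prod.ext_iff.1 h).2).2
    apply hU
    have h3 : (U σ).map G = (U τ).map G := by
      rw [List.eq_iff_flatten_eq]
      refine ⟨h2, ?_⟩
      have hc : List.length ∘ G = fun _ => (G true).length := funext fun b => hGlen _ _
      simp [List.map_map, hc, List.map_const', hlen_eq]
    exact List.map_injective_iff.2 hGinj h3
  have h := hk fun i => ((u i).map g).prod
  simp only [hprod] at h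
  have h' := congrArg (fun z => ρ z (Finsupp.single (v, none, []) 1)) h
  simp only [map_sum, map_zero, LinearMap.zero_apply, LinearMap.sum_apply, Units.smul_def,
    map_zsmul, LinearMap.smul_apply, ht] at h'
  have h'' := DFunLike.congr_fun h' (v, t (U 1), ((U 1).map G).flatten)
  rw [Finsupp.finsetSum_apply, Finset.sum_eq_single 1] at h''
  · simp at h''
  · intro σ _ hσ
    rw [Finsupp.smul_apply, Finsupp.single_eq_of_ne, smul_zero]
    exact fun e => hσ (hF e.symm)
  · simp

/-- A path that starts and ends in different link components of a vertex absorbs the face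
cycle at its start. -/
lemma IsDimer.pathE_mul_cycle (hD : D.IsDimer) [Module.Finite (Subring.center D.Jac) D.Jac]
    {a b : D.E} (hab : D.ltl a ≠ D.lhd b) {q p : List D.E}
    (H : Walk D.hd D.tl (D.tl a) (D.tl a) (b :: q)) {r : List D.E} (hr : b :: q = r ++ [a])
    (hp : D.Comp a p) :
    D.pathE (b :: q) * D.pathE (p ++ [a]) = D.pathE (b :: q) := by
  have hpw := (Walk.singleton (h := D.hd) (t := D.tl) a).append (hD.comp_walk hp)
  have hpl := (Walk.singleton (h := D.lhd) (t := D.ltl) a).append (hD.comp_lwalk hp)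
  obtain ⟨ρ, hρ⟩ := exists_rep_pieces hD
  have hx : (p ++ [a]).foldr step (none, []) = (some (D.ltl a), [D.pathE (p ++ [a])]) := by
    rw [foldr_step_lwalk hpl (by simp)]; rfl
  have hfst : ∀ ω, ((b :: q).foldr step ω).1 = some (D.lhd b) := fun ω => by
    rw [List.foldr_cons, step_fst]
  have hs : ∀ (t : Option D.Link) (ms : List D.Jac), (ms = [] ∨ t = some (D.lhd b)) →
      (ms = [] ∨ t ≠ some (D.ltl a)) := by
    rintro t ms (h | rfl)
    · exact .inl h
    · exact .inr fun h => hab (Option.some.inj h).symm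
  let P : Bool → List D.E := fun c => if c then b :: q ++ (p ++ [a]) else b :: q
  have hW : ∀ c, Walk D.hd D.tl (D.tl a) (D.tl a) (P c) := by
    intro c
    cases c
    · exact H
    · exact hpw.append H
  have hcut : ∀ c t ms, (ms = [] ∨ t = some (D.lhd b)) →
      (P c).foldr step (t, ms) = (some (D.lhd b), pieces (P c) ++ ms) := by
    intro c t ms h
    cases c
    · have e : P false = r ++ [a] := hr
      rw [e, foldr_step_of_cut _ _ _ _ (hs t ms h), ← hr, hfst]
    · have e : P true = (b :: q ++ p) ++ [a] := by simp [P]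
      rw [e, foldr_step_of_cut _ _ _ _ (hs t ms h)]
      congr 1
      rw [List.cons_append, List.cons_append, List.foldr_cons, step_fst]
  have key : pieces (P true) = pieces (P false) := by
    refine pieces_eq (G := fun c => pieces (P c)) (g := fun c => D.pathE (P c)) ρ
      (v := D.tl a) (s := some (D.lhd b)) ?_ ?_
    · intro c t ms h
      rw [hρ (hW c), hcut c t ms h]
    · have e1 : pieces (P true) = ((b :: q).foldr step (some (D.ltl a), [D.pathE (p ++ [a])])).2 := by
        simp only [P, if_true]
        unfold pieces
        rw [List.foldr_append, hx]
      have e2 : pieces (P false) = pieces (b :: q) := rfl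
      simp only [e1, e2]
      rw [hr]
      exact (length_foldr_step r a _).2.2
  have := congrArg List.prod key
  rw [prod_pieces, prod_pieces] at this
  rw [← pathE_append]
  exact this

lemma arrow_mul_pathE_of_ne {v w : D.V} {a : D.E} {p : List D.E}
    (H : Walk D.hd D.tl v w p) (hp : p ≠ []) (h : D.tl a ≠ w) :
    D.pathE [a] * D.pathE p = 0 := by
  rw [← arrow_mul_vtx, ← vtx_mul_pathE H hp, mul_assoc, ← mul_assoc (D.vtx _),
    vtx_mul_vtx h, zero_mul, mul_zero]

/-- The left ideal generated by an arrow is spanned by the paths starting with it. -/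
lemma mul_arrow_mem_span (a : D.E) (z : D.Jac) :
    z * D.pathE [a] ∈ Submodule.span ℂ
      {x | ∃ w r, Walk D.hd D.tl (D.tl a) w (r ++ [a]) ∧ x = D.pathE (r ++ [a])} := by
  set S := Submodule.span ℂ
      {x | ∃ w r, Walk D.hd D.tl (D.tl a) w (r ++ [a]) ∧ x = D.pathE (r ++ [a])} with hS
  have gen : ∀ y : D.Jac, (∀ w r, Walk D.hd D.tl (D.tl a) w (r ++ [a]) →
      y * D.pathE (r ++ [a]) ∈ S) → ∀ x ∈ S, y * x ∈ S := by
    intro y hy x hx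
    induction hx using Submodule.span_induction with
    | mem x h => obtain ⟨w, r, h1, rfl⟩ := h; exact hy w r h1
    | zero => rw [mul_zero]; exact S.zero_mem
    | add x x' _ _ h h' => rw [mul_add]; exact S.add_mem h h'
    | smul c x _ h => rw [mul_smul_comm]; exact S.smul_mem c h
  have key : ∀ y : D.pre, ∀ x ∈ S, D.toJac y * x ∈ S := by
    intro y
    induction y using FreeAlgebra.induction with
    | grade0 c =>
      intro x hx
      have : D.toJac (algebraMap ℂ D.pre c) = algebraMap ℂ D.Jac c := by
        rw [toJac, ← RingQuot.mkAlgHom_coe ℂ]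
        exact AlgHom.commutes _ c
      rw [this, ← Algebra.smul_def]
      exact S.smul_mem c hx
    | grade1 g =>
      apply gen
      intro w r H
      cases g with
      | vert v =>
        change D.vtx v * _ ∈ S
        by_cases h : v = w
        · subst h
          rw [vtx_mul_pathE H (by simp)]
          exact Submodule.subset_span ⟨v, r, H, rfl⟩
        · rw [← vtx_mul_pathE H (by simp), ← mul_assoc, vtx_mul_vtx h, zero_mul]
          exact S.zero_mem
      | arr e =>
        change D.toJac (D.genE e) * _ ∈ S
        rw [← pathE_singleton]
        by_cases h : D.tl e = w
        · rw [← pathE_cons]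
          exact Submodule.subset_span ⟨D.hd e, e :: r, H.cons h, rfl⟩
        · rw [arrow_mul_pathE_of_ne H (by simp) h]
          exact S.zero_mem
    | mul y y' h h' =>
      intro x hx
      rw [map_mul, mul_assoc]
      exact h _ (h' x hx)
    | add y y' h h' =>
      intro x hx
      rw [map_add, add_mul]
      exact S.add_mem (h x hx) (h' x hx)
  obtain ⟨y, rfl⟩ := RingQuot.mkRingHom_surjective _ z
  exact key y _ (Submodule.subset_span ⟨D.hd a, [], Walk.singleton a, rfl⟩)

/-- Links of vertices are connected. -/
lemma IsDimer.ltl_eq_lhd (hD : D.IsDimer) [Module.Finite (Subring.center D.Jac) D.Jac]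
    (hprime : ∀ x y : D.Jac, (∀ z : D.Jac, x * z * y = 0) → x = 0 ∨ y = 0)
    {a b : D.E} (h : D.tl a = D.hd b) : D.ltl a = D.lhd b := by
  by_contra hab
  obtain ⟨p, hp⟩ := hD.exists_posComp a
  have hp : D.Comp a p := hp.imp fun c h => ⟨.inl h.1, h.2⟩
  have hw := (Walk.singleton (h := D.hd) (t := D.tl) a).append (hD.comp_walk hp)
  have hab' : D.pathE [b] = 0 ∨ D.pathE [a] * (1 - D.pathE (p ++ [a])) = 0 := by
    apply hprime
    intro z
    rw [mul_assoc, ← mul_assoc z]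
    have hz := mul_arrow_mem_span a z
    generalize z * D.pathE [a] = x at hz
    induction hz using Submodule.span_induction with
    | mem x hx =>
      obtain ⟨w, r, H, rfl⟩ := hx
      rw [← mul_assoc]
      by_cases e : D.tl b = w
      · have H' := H.cons (h := D.hd) e
        rw [← h] at H'
        rw [← pathE_cons, mul_sub, mul_one,
          hD.pathE_mul_cycle hab H' (r := b :: r) rfl hp, sub_self]
      · rw [arrow_mul_pathE_of_ne H (by simp) e, zero_mul]
    | zero => simp
    | add x y _ _ hx hy => rw [add_mul, mul_add, hx, hy, add_zero]
    | smul c x _ hx => rw [smul_mul_assoc, mul_smul_comm, hx, smul_zero]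
  rcases hab' with h0 | h0
  · exact hD.pathE_ne_zero (Walk.singleton b) h0
  · rw [mul_sub, mul_one, ← pathE_append, sub_eq_zero] at h0
    refine hD.arrow_ne (hw.append (Walk.singleton a)) rfl ?_ h0
    simp

/-- The face cycle attached to a link component. -/
lemma IsDimer.exists_cycle (hD : D.IsDimer) :
    ∃ F : D.Link → D.Jac, ∀ a p, D.Comp a p →
      F (D.ltl a) = D.pathE (p ++ [a]) ∧ F (D.lhd a) = D.pathE (a :: p) := by
  choose P hP using hD.exists_posComp
  have hP : ∀ a, D.Comp a (P a) := fun a => (hP a).imp fun c h => ⟨.inl h.1, h.2⟩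
  have hP' : ∀ {a p}, D.Comp a p → D.pathE (P a) = D.pathE p :=
    fun h => hD.pathE_comp_eq (hP _) h
  refine ⟨Quot.lift (Sum.elim (fun a => D.pathE (a :: P a)) fun a => D.pathE (P a ++ [a])) ?_,
    fun a p h => ⟨?_, ?_⟩⟩
  · rintro _ _ ⟨h⟩
    rename_i x y q
    have h2 : D.Comp y (q ++ [x]) := by
      obtain ⟨c, hc, hr⟩ := h
      exact ⟨c, hc, (List.isRotated_append (l := y :: q) (l' := [x])).trans hr⟩
    simp only [Sum.elim_inl, Sum.elim_inr]
    rw [pathE_append, hP' h, pathE_cons y (P y), hP' h2, ← pathE_append, ← pathE_cons]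
    simp
  · change D.pathE (P a ++ [a]) = _
    rw [pathE_append, hP' h, pathE_append]
  · change D.pathE (a :: P a) = _
    rw [pathE_cons, hP' h, ← pathE_cons]

/-- The face cycles at the vertices sum to a central element. -/
lemma IsDimer.exists_central (hD : D.IsDimer)
    (hlink : ∀ a b : D.E, D.tl a = D.hd b → D.ltl a = D.lhd b) :
    ∃ ℓ : D.Jac, (∀ z, ℓ * z = z * ℓ) ∧ ∀ a p, D.Comp a p →
      D.vtx (D.tl a) * ℓ = D.pathE (p ++ [a]) ∧ D.vtx (D.hd a) * ℓ = D.pathE (a :: p) := by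
  obtain ⟨F, hF⟩ := hD.exists_cycle
  have hcomp : ∀ a, ∃ p, D.Comp a p := fun a =>
    (hD.exists_posComp a).imp fun p h => h.imp fun c h => ⟨.inl h.1, h.2⟩
  let L : D.V → D.Jac := fun v => if h : ∃ a, D.hd a = v then F (D.lhd h.choose) else 0
  have hin : ∀ a : D.E, ∃ b, D.tl b = D.hd a := by
    intro a
    obtain ⟨p, hp⟩ := hcomp a
    have hw := hD.comp_walk hp
    rcases p.eq_nil_or_concat with rfl | ⟨r, b, rfl⟩
    · simpa using hD.two_le_length hp
    · rw [List.concat_eq_append] at hw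
      exact ⟨b, hw.tail_eq⟩
  have hout : ∀ a : D.E, ∃ b, D.hd b = D.tl a := by
    intro a
    obtain ⟨p, hp⟩ := hcomp a
    have hw := hD.comp_walk hp
    cases p with
    | nil => simpa using hD.two_le_length hp
    | cons b q => exact ⟨b, hw.head_eq.symm⟩
  have hLin : ∀ a, L (D.hd a) = F (D.lhd a) := by
    intro a
    have h : ∃ b, D.hd b = D.hd a := ⟨a, rfl⟩
    obtain ⟨c, hc⟩ := hin a
    simp only [L, dif_pos h]
    rw [← hlink c a hc, hlink c _ (hc.trans h.choose_spec.symm)]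
  have hLout : ∀ a, L (D.tl a) = F (D.ltl a) := by
    intro a
    obtain ⟨b, hb⟩ := hout a
    rw [← hb, hLin, hlink a b hb.symm]
  have hL : ∀ v, D.vtx v * L v = L v ∧ L v * D.vtx v = L v := by
    intro v
    by_cases h : ∃ a, D.hd a = v
    · obtain ⟨a, rfl⟩ := h
      obtain ⟨p, hp⟩ := hcomp a
      have hw := (hD.comp_walk hp).cons (h := D.hd) (a := a) rfl
      rw [hLin, (hF a p hp).2]
      exact ⟨vtx_mul_pathE hw (by simp), pathE_mul_vtx hw (by simp)⟩
    · simp [L, h]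
  have hl : ∀ v, D.vtx v * ∑ w, L w = L v := by
    intro v
    rw [Finset.mul_sum, Finset.sum_eq_single v, (hL v).1]
    · intro w _ hw
      rw [← (hL w).1, ← mul_assoc, vtx_mul_vtx hw.symm, zero_mul]
    · simp
  have hr : ∀ v, (∑ w, L w) * D.vtx v = L v := by
    intro v
    rw [Finset.sum_mul, Finset.sum_eq_single v, (hL v).2]
    · intro w _ hw
      rw [← (hL w).2, mul_assoc, vtx_mul_vtx hw, mul_zero]
    · simp
  refine ⟨∑ v, L v, fun z => ?_, fun a p hp => ⟨?_, ?_⟩⟩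
  · obtain ⟨y, rfl⟩ := RingQuot.mkRingHom_surjective _ z
    change _ * D.toJac y = D.toJac y * _
    induction y using FreeAlgebra.induction with
    | grade0 c =>
      obtain ⟨x, hx⟩ := RingQuot.mkRingHom_surjective D.JRel (∑ v, L v)
      rw [← hx]
      change D.toJac x * _ = _ * D.toJac x
      rw [← map_mul, ← map_mul, Algebra.commutes]
    | grade1 g =>
      cases g with
      | vert v => exact (hr v).trans (hl v).symm
      | arr a =>
        change _ * D.toJac (D.genE a) = D.toJac (D.genE a) * _
        obtain ⟨p, hp⟩ := hcomp a
        rw [← pathE_singleton]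
        calc (∑ v, L v) * D.pathE [a] = (∑ v, L v) * (D.vtx (D.hd a) * D.pathE [a]) := by
              rw [vtx_mul_arrow]
          _ = D.pathE (a :: p) * D.pathE [a] := by rw [← mul_assoc, hr, hLin, (hF a p hp).2]
          _ = D.pathE [a] * D.pathE (p ++ [a]) := by simp only [← pathE_append]; rfl
          _ = D.pathE [a] * D.vtx (D.tl a) * ∑ v, L v := by
              rw [mul_assoc, hl, hLout, (hF a p hp).1]
          _ = D.pathE [a] * ∑ v, L v := by rw [arrow_mul_vtx]
    | mul y y' h h' => rw [map_mul, ← mul_assoc, h, mul_assoc, h', mul_assoc]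
    | add y y' h h' => rw [map_add, mul_add, add_mul, h, h']
  · rw [hl, hLout, (hF a p hp).1]
  · rw [hl, hLin, (hF a p hp).2]

end Main

end DimerData

open DimerData in
/-- If the Jacobi algebra of a dimer model is an order — a prime
algebra which is a finitely generated module over its center — then it is a
cancellation algebra. -/
theorem cancellation_of_order (D : DimerData) [Fintype D.V] (hD : D.IsDimer)
    (hprime : ∀ x y : D.Jac, (∀ z : D.Jac, x * z * y = 0) → x = 0 ∨ y = 0)
    (hfin : Module.Finite (Subring.center D.Jac) D.Jac) :
    D.Cancellation := by
  intro a p q v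
  obtain ⟨ℓ, hcomm, hℓ⟩ := hD.exists_central fun a b h => hD.ltl_eq_lhd hprime h
  obtain ⟨r, hr⟩ := hD.exists_posComp a
  have hr : D.Comp a r := hr.imp fun c h => ⟨.inl h.1, h.2⟩
  obtain ⟨htl, hhd⟩ := hℓ a r hr
  have hne : ℓ ≠ 0 := by
    rintro rfl
    rw [mul_zero] at hhd
    exact hD.pathE_ne_zero ((hD.comp_walk hr).cons (h := D.hd) rfl) hhd.symm
  have hreg : ∀ x, x * ℓ = 0 → x = 0 := fun x hx =>
    (hprime x ℓ fun z => by rw [mul_assoc, ← hcomm, ← mul_assoc, hx, zero_mul]).resolve_right hne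
  refine ⟨fun hp hq h => ?_, fun hp hq h => ?_⟩
  · rw [← sub_eq_zero]
    apply hreg
    have h1 := pathAt_mul_vtx (walk_of_pathFrom hp)
    have h2 := pathAt_mul_vtx (walk_of_pathFrom hq)
    rw [← h1, ← h2, ← sub_mul, mul_assoc, hhd, pathE_cons, ← mul_assoc, sub_mul, h, sub_self,
      zero_mul]
  · rw [← sub_eq_zero]
    apply hreg
    have h1 := vtx_mul_pathAt (walk_of_pathFrom hp)
    have h2 := vtx_mul_pathAt (walk_of_pathFrom hq)
    rw [← hcomm, ← h1, ← h2, ← mul_sub, ← mul_assoc, hcomm, htl, pathE_append, mul_assoc, mul_sub,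
      h, sub_self, mul_zero]
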